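/- There exists a bijection c : ℕ ≃ ℕ such that c ∘ S ∘ c⁻¹ is primitive recursive (where S x = x + 1), the conjugate c ∘ (x ↦ 2·x) ∘ c⁻¹ of the doubling function is primitive recursive, and for all natural numbers m, b with m > 0, the conjugate c ∘ (x ↦ m·x + b) ∘ c⁻¹ is primitive recursive if and only if m is a power of 2 (i.e., m = 2^a for some a ∈ ℕ). -/

import Mathlib

open Nat.Partrec (Code)

/-- There is a function that eventually dominates every primitive recursive function, whose graph
is primitive recursive and which has a primitive recursive left inverse. -/
theorem exists_dominating_primrec_graph : ∃ κ u : ℕ → ℕ,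
    PrimrecRel (fun s k => κ s = k) ∧ Primrec u ∧ (∀ s, u (κ s) = s) ∧
    ∀ f : ℕ → ℕ, Primrec f → ∃ N, ∀ s, N ≤ s → f s < κ s := by
  classical
  have hack : Computable (fun s => ack s s) := computable₂_ack.comp Computable.id Computable.id
  obtain ⟨c, hc⟩ := Code.exists_code.1 (Partrec.nat_iff.1 hack.partrec)
  let P : ℕ → ℕ → Prop := fun k s => (Code.evaln k c s).getD (k + 1) ≤ k
  have hP : PrimrecRel P :=
    Primrec.nat_le.comp
      (Primrec.option_getD.comp
        (Code.primrec_evaln.comp ((Primrec.fst.pair (Primrec.const c)).pair Primrec.snd))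
        (Primrec.succ.comp Primrec.fst))
      Primrec.fst
  have hPack : ∀ k s, P k s → ack s s ≤ k := by
    intro k s h
    rcases hv : Code.evaln k c s with _ | v
    · simp [P, hv] at h
    · have hs : v ∈ Code.eval c s := Code.evaln_sound hv
      rw [hc] at hs
      have hv' : v = ack s s := by simpa using hs
      simpa [P, hv, hv'] using h
  have hex : ∀ s, ∃ k, P k s := by
    intro s
    have hs : ack s s ∈ Code.eval c s := by rw [hc]; simp
    obtain ⟨k, hk⟩ := Code.evaln_complete.1 hs
    refine ⟨max k (ack s s), ?_⟩
    have := Code.evaln_mono (le_max_left k (ack s s)) hk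
    simp only [Option.mem_def] at this
    simp [P, this]
  refine ⟨fun s => Nat.pair s (Nat.find (hex s)), fun n => n.unpair.1, ?_,
    Primrec.fst.comp Primrec.unpair, fun s => by simp, fun f hf => ?_⟩
  · have hr : PrimrecRel fun s k : ℕ =>
        k.unpair.1 = s ∧ P k.unpair.2 s ∧ ∀ j < k.unpair.2, ¬ P j s := by
      have h1 : Primrec fun p : ℕ × ℕ => p.2.unpair.1 :=
        Primrec.fst.comp (Primrec.unpair.comp Primrec.snd)
      have h2 : Primrec fun p : ℕ × ℕ => p.2.unpair.2 :=
        Primrec.snd.comp (Primrec.unpair.comp Primrec.snd)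
      exact (Primrec.eq.comp h1 Primrec.fst).and
        ((hP.comp h2 Primrec.fst).and (hP.not.forall_lt.comp h2 Primrec.fst))
    refine hr.of_eq fun s k => ?_
    constructor
    · rintro ⟨h1, h2⟩
      show Nat.pair s (Nat.find (hex s)) = k
      rw [(Nat.find_eq_iff (hex s)).2 h2, ← h1, Nat.pair_unpair]
    · rintro rfl
      simpa using (Nat.find_eq_iff (hex s)).1 rfl
  · obtain ⟨m, hm⟩ := exists_lt_ack_of_nat_primrec (Primrec.nat_iff.1 hf)
    refine ⟨m, fun s hs => ?_⟩
    calc f s < ack m s := hm s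
      _ ≤ ack s s := ack_mono_left s hs
      _ ≤ Nat.find (hex s) := hPack _ _ (Nat.find_spec (hex s))
      _ ≤ Nat.pair s (Nat.find (hex s)) := Nat.right_le_pair _ _

theorem Primrec.nat_count {p : ℕ → Prop} [DecidablePred p] (hp : PrimrecPred p) :
    Primrec (Nat.count p) := by
  have h : Primrec fun n => (List.filter (fun i => decide (p i)) (List.range n)).length :=
    Primrec.list_length.comp ((Primrec.listFilter hp).comp Primrec.list_range)
  exact h.of_eq fun n => by rw [Nat.count, List.countP_eq_length_filter]

theorem Primrec.sum_range {f : ℕ → ℕ} (hf : Primrec f) :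
    Primrec fun n => ∑ i ∈ Finset.range n, f i := by
  have h : Primrec (Nat.rec 0 fun i s => s + f i : ℕ → ℕ) :=
    Primrec.nat_rec₁ 0 (Primrec.nat_add.comp Primrec.snd (hf.comp Primrec.fst))
  refine h.of_eq fun n => ?_
  induction n with
  | zero => rfl
  | succ n ih => rw [Finset.sum_range_succ, ← ih]

/-- Given a primitive recursive injection `e` of `ℕ` such that `e ∘ d` is primitive recursive for
some left inverse `d`, its range can be identified with `ℕ` primitive recursively. -/
theorem exists_equiv_of_primrec_retract {α : Type*} [Denumerable α] (e : ℕ → α) (d : α → ℕ)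
    (he : Primrec e) (hd : ∀ n, d (e n) = n) (hed : Primrec fun y => e (d y)) :
    ∃ c : ℕ ≃ ℕ,
      (∀ f : ℕ → ℕ, Primrec (fun y => e (f (d y))) → Primrec fun x => c (f (c.symm x))) ∧
      (∀ f : ℕ → ℕ, Primrec (fun x => c (f (c.symm x))) →
        ∃ g : α → α, Primrec g ∧ ∀ n, g (e n) = e (f n)) := by
  classical
  let p : ℕ → Prop := fun i => Encodable.encode (e (d (Denumerable.ofNat α i))) = i
  have hp : PrimrecPred p :=
    Primrec.eq.comp (Primrec.encode.comp (hed.comp (Primrec.ofNat α))) Primrec.id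
  have hpe : ∀ n, p (Encodable.encode (e n)) := fun n => by simp [p, hd]
  have hinj : Function.Injective fun n => Encodable.encode (e n) :=
    Encodable.encode_injective.comp (Function.LeftInverse.injective hd)
  have hinf : (Set.ofPred p).Infinite :=
    Set.infinite_of_injective_forall_mem hinj hpe
  have hcount : Primrec (Nat.count p) := Primrec.nat_count hp
  let B : ℕ → ℕ := fun n => ∑ i ∈ Finset.range (n + 1), Encodable.encode (e i)
  have hB : Primrec B := (Primrec.sum_range (Primrec.encode.comp he)).comp Primrec.succ
  have hnthB : ∀ n, Nat.nth p n ≤ B n := by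
    intro n
    refine Nat.lt_succ_iff.1 (Nat.nth_lt_of_lt_count ?_)
    rw [Nat.count_eq_card_filter_range, Nat.lt_iff_add_one_le]
    calc n + 1 = ((Finset.range (n + 1)).image fun i => Encodable.encode (e i)).card := by
          rw [Finset.card_image_of_injective _ hinj, Finset.card_range]
      _ ≤ _ := by
          refine Finset.card_le_card fun y hy => ?_
          obtain ⟨i, hi, rfl⟩ := Finset.mem_image.1 hy
          refine Finset.mem_filter.2 ⟨Finset.mem_range.2 (Nat.lt_succ_iff.2 ?_), hpe i⟩
          exact Finset.single_le_sum (f := fun i => Encodable.encode (e i))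
            (fun _ _ => Nat.zero_le _) hi
  have hnth : Primrec (Nat.nth p) := by
    have hr : PrimrecRel fun n y : ℕ => p y ∧ Nat.count p y = n :=
      PrimrecPred.and (hp.comp Primrec.snd)
        (Primrec.eq.comp (hcount.comp Primrec.snd) Primrec.fst)
    refine (Primrec.nat_findGreatest hB hr).of_eq fun n => ?_
    have h : p (Nat.nth p n) ∧ Nat.count p (Nat.nth p n) = n :=
      ⟨Nat.nth_mem_of_infinite hinf n, Nat.count_nth_of_infinite hinf n⟩
    have hs := Nat.findGreatest_spec (P := fun y => p y ∧ Nat.count p y = n) (hnthB n) h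
    exact Nat.count_injective hs.1 h.1 (hs.2.trans h.2.symm)
  let r : α → ℕ := fun y => Nat.count p (Encodable.encode y)
  let q : ℕ → α := fun x => Denumerable.ofNat α (Nat.nth p x)
  have hr : Primrec r := hcount.comp Primrec.encode
  have hq : Primrec q := (Primrec.ofNat α).comp hnth
  have hqr : ∀ n, q (r (e n)) = e n := fun n => by simp [q, r, Nat.nth_count (hpe n)]
  have hedq : ∀ x, e (d (q x)) = q x := fun x => by
    have h : Encodable.encode (e (d (q x))) = Nat.nth p x := Nat.nth_mem_of_infinite hinf x
    rw [← Denumerable.ofNat_encode (e (d (q x))), h]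
  have hrq : ∀ x, r (q x) = x := fun x => by simp [q, r, Nat.count_nth_of_infinite hinf]
  refine ⟨⟨fun n => r (e n), fun x => d (q x), fun n => by simp [hqr, hd],
    fun x => by simp [hedq, hrq]⟩, fun f hf => ?_, fun f hf => ?_⟩
  · exact hr.comp (hf.comp hq)
  · have hf' : Primrec fun x => r (e (f (d (q x)))) := hf
    refine ⟨fun y => q (r (e (f (d (q (r y)))))), hq.comp (hf'.comp hr), fun n => ?_⟩
    simp only [hqr, hd]

theorem Primrec.nat_pow : Primrec₂ ((· ^ ·) : ℕ → ℕ → ℕ) :=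
  Primrec₂.unpaired'.1 Nat.Primrec.pow

theorem Primrec.nat_log_two : Primrec (Nat.log 2) := by
  have hr : PrimrecRel fun n j : ℕ => 2 ^ j ≤ n :=
    Primrec.nat_le.comp (Primrec.nat_pow.comp (Primrec.const 2) Primrec.snd) Primrec.fst
  refine (Primrec.nat_findGreatest Primrec.id hr).of_eq fun n => ?_
  rw [id, Nat.findGreatest_eq_iff]
  refine ⟨Nat.log_le_self 2 n, fun h => Nat.pow_log_le_self 2 ?_, fun j hj _ h => ?_⟩
  · rintro rfl
    simp at h
  · exact absurd (Nat.lt_pow_of_log_lt one_lt_two hj) (not_lt.2 h)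

/-- The label of `n`: the triple `(s + 1, a, b)` if `n = 2 ^ (κ s * κ s + a) + b` with
`a, b < κ s`, and `(0, n, 0)` otherwise. Here `u` is a left inverse of `κ`. -/
def label (κ u : ℕ → ℕ) (n : ℕ) : ℕ × ℕ × ℕ :=
  if κ (u (Nat.log 2 n).sqrt) = (Nat.log 2 n).sqrt ∧
      Nat.log 2 n - (Nat.log 2 n).sqrt * (Nat.log 2 n).sqrt < (Nat.log 2 n).sqrt ∧
      n - 2 ^ Nat.log 2 n < (Nat.log 2 n).sqrt then
    (u (Nat.log 2 n).sqrt + 1,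
      Nat.log 2 n - (Nat.log 2 n).sqrt * (Nat.log 2 n).sqrt, n - 2 ^ Nat.log 2 n)
  else (0, n, 0)

/-- The number carrying a given label. -/
def unlabel (κ : ℕ → ℕ) (y : ℕ × ℕ × ℕ) : ℕ :=
  if y.1 = 0 then y.2.1 else 2 ^ (κ (y.1 - 1) * κ (y.1 - 1) + y.2.1) + y.2.2

theorem lt_two_pow_sq_add {k b : ℕ} (a : ℕ) (hb : b < k) : b < 2 ^ (k * k + a) :=
  hb.trans <| Nat.lt_two_pow_self.trans_le <| Nat.pow_le_pow_right two_pos <| by nlinarith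

theorem log_two_pow_add {i b : ℕ} (hb : b < 2 ^ i) : Nat.log 2 (2 ^ i + b) = i :=
  Nat.log_eq_of_pow_le_of_lt_pow (by omega) (by rw [pow_succ]; omega)

section label

variable {κ u : ℕ → ℕ}

theorem label_two_pow_add (hu : ∀ s, u (κ s) = s) {s a b : ℕ} (ha : a < κ s) (hb : b < κ s) :
    label κ u (2 ^ (κ s * κ s + a) + b) = (s + 1, a, b) := by
  have hsqrt : Nat.sqrt (κ s * κ s + a) = κ s := Nat.sqrt_add_eq _ (by omega)
  simp [label, log_two_pow_add (lt_two_pow_sq_add a hb), hsqrt, hu, ha, hb]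

theorem unlabel_label (n : ℕ) : unlabel κ (label κ u n) = n := by
  unfold label
  split_ifs with h
  · have hn : n ≠ 0 := by
      rintro rfl
      simp at h
    have h1 := Nat.pow_log_le_self 2 hn
    have h2 := Nat.sqrt_le (Nat.log 2 n)
    simp only [unlabel, Nat.add_sub_cancel, h.1]
    simp only [Nat.add_eq_zero_iff, one_ne_zero, and_false, if_false]
    rw [Nat.add_sub_cancel' h2]
    omega
  · simp [unlabel]

theorem primrec_label (hκ : PrimrecRel fun s k => κ s = k) (hu : Primrec u) :
    Primrec (label κ u) := by
  have hl : Primrec fun n : ℕ => Nat.log 2 n := Primrec.nat_log_two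
  have hs : Primrec fun n : ℕ => (Nat.log 2 n).sqrt := Primrec.nat_sqrt.comp hl
  have hus := hu.comp hs
  have ha : Primrec fun n : ℕ => Nat.log 2 n - (Nat.log 2 n).sqrt * (Nat.log 2 n).sqrt :=
    Primrec.nat_sub.comp hl (Primrec.nat_mul.comp hs hs)
  have hb : Primrec fun n : ℕ => n - 2 ^ Nat.log 2 n :=
    Primrec.nat_sub.comp Primrec.id (Primrec.nat_pow.comp (Primrec.const 2) hl)
  exact Primrec.ite
    ((hκ.comp hus hs).and ((Primrec.nat_lt.comp ha hs).and (Primrec.nat_lt.comp hb hs)))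
    ((Primrec.succ.comp hus).pair (ha.pair hb))
    ((Primrec.const 0).pair (Primrec.id.pair (Primrec.const 0)))

theorem primrec_label_two_pow (hκ : PrimrecRel fun s k => κ s = k) (hu : Primrec u)
    (huκ : ∀ s, u (κ s) = s) :
    Primrec fun y : ℕ × ℕ × ℕ => label κ u (2 ^ (κ y.1 * κ y.1 + y.2.1) + y.2.2) := by
  classical
  have ha : Primrec fun y : ℕ × ℕ × ℕ => y.2.1 := Primrec.fst.comp Primrec.snd
  have hb : Primrec fun y : ℕ × ℕ × ℕ => y.2.2 := Primrec.snd.comp Primrec.snd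
  let k : ℕ × ℕ × ℕ → ℕ := fun y => Nat.findGreatest (fun k => κ y.1 = k) (y.2.1 + y.2.2)
  have hk : Primrec k :=
    Primrec.nat_findGreatest (Primrec.nat_add.comp ha hb)
      (hκ.comp (Primrec.fst.comp Primrec.fst) Primrec.snd)
  have h : Primrec fun y : ℕ × ℕ × ℕ =>
      if κ y.1 = k y then label κ u (2 ^ (k y * k y + y.2.1) + y.2.2)
      else (y.1 + 1, y.2.1, y.2.2) :=
    Primrec.ite (hκ.comp Primrec.fst hk)
      ((primrec_label hκ hu).comp (Primrec.nat_add.comp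
        (Primrec.nat_pow.comp (Primrec.const 2) (Primrec.nat_add.comp
          (Primrec.nat_mul.comp hk hk) ha)) hb))
      ((Primrec.succ.comp Primrec.fst).pair (ha.pair hb))
  refine h.of_eq fun y => ?_
  split_ifs with hy
  · rw [← hy]
  · have hlt : y.2.1 + y.2.2 < κ y.1 := by
      by_contra! hle
      exact hy (Nat.findGreatest_spec (P := fun k => κ y.1 = k) hle rfl)
    rw [label_two_pow_add huκ (by omega) (by omega)]

theorem primrec_label_comp_unlabel (hκ : PrimrecRel fun s k => κ s = k) (hu : Primrec u)
    (huκ : ∀ s, u (κ s) = s) (f : ℕ → ℕ) (hf : Primrec f) (g : ℕ × ℕ → ℕ × ℕ) (hg : Primrec g)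
    (hfg : ∀ i a b, f (2 ^ (i + a) + b) = 2 ^ (i + (g (a, b)).1) + (g (a, b)).2) :
    Primrec fun y => label κ u (f (unlabel κ y)) := by
  have h : Primrec fun y : ℕ × ℕ × ℕ =>
      if y.1 = 0 then label κ u (f y.2.1)
      else label κ u (2 ^ (κ (y.1 - 1) * κ (y.1 - 1) + (g y.2).1) + (g y.2).2) :=
    Primrec.ite (Primrec.eq.comp Primrec.fst (Primrec.const 0))
      ((primrec_label hκ hu).comp (hf.comp (Primrec.fst.comp Primrec.snd)))
      ((primrec_label_two_pow hκ hu huκ).comp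
        ((Primrec.pred.comp Primrec.fst).pair (hg.comp Primrec.snd)))
  refine h.of_eq fun y => ?_
  unfold unlabel
  split_ifs <;> simp [hfg]

theorem eq_two_pow_of_label {s m b : ℕ} (hm : 0 < m) (hms : m < κ s)
    (hbs : b < κ s) (h : (label κ u (m * 2 ^ (κ s * κ s) + b)).2.1 < κ s) :
    ∃ a, m = 2 ^ a := by
  set k := κ s
  have hk : k < 2 ^ (k * k) :=
    Nat.lt_two_pow_self.trans_le <| Nat.pow_le_pow_right two_pos <| Nat.le_mul_self k
  set n := m * 2 ^ (k * k) + b with hn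
  have hi := Nat.pow_log_le_self 2 hm.ne'
  have hi' := Nat.lt_pow_succ_log_self one_lt_two m
  have hik : Nat.log 2 m < k := (Nat.log_le_self 2 m).trans_lt hms
  set i := Nat.log 2 m
  obtain ⟨t, ht⟩ := Nat.exists_eq_add_of_le hi
  have hlog : Nat.log 2 n = k * k + i := by
    refine Nat.log_eq_of_pow_le_of_lt_pow ?_ ?_
    · rw [pow_add]; nlinarith
    · rw [add_assoc, pow_add]
      have : (m + 1) * 2 ^ (k * k) ≤ 2 ^ (i + 1) * 2 ^ (k * k) := Nat.mul_le_mul_right _ hi'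
      nlinarith
  have hsqrt : Nat.sqrt (k * k + i) = k := Nat.sqrt_add_eq _ (by omega)
  have hsub : n - 2 ^ (k * k + i) = t * 2 ^ (k * k) + b := by
    rw [hn, ht, pow_add, add_mul, mul_comm (2 ^ i), add_assoc, Nat.add_sub_cancel_left]
  rw [label, hlog, hsqrt, hsub] at h
  split_ifs at h with hc
  · have h0 : t = 0 := by
      by_contra hne
      have := hc.2.2
      have : 2 ^ (k * k) ≤ t * 2 ^ (k * k) := Nat.le_mul_of_pos_left _ (Nat.pos_of_ne_zero hne)
      omega
    exact ⟨i, by omega⟩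
  · have h' : n < k := h
    have : 2 ^ (k * k) ≤ m * 2 ^ (k * k) := Nat.le_mul_of_pos_left _ hm
    omega

end label

theorem stmt_14 : ∃ c : ℕ ≃ ℕ,
    Primrec (fun x => c (c.symm x + 1)) ∧
    Primrec (fun x => c (2 * c.symm x)) ∧
    ∀ m b : ℕ, 0 < m →
      (Primrec (fun x => c (m * c.symm x + b)) ↔ ∃ a : ℕ, m = 2 ^ a) := by
  obtain ⟨κ, u, hκ, hu, huκ, hdom⟩ := exists_dominating_primrec_graph
  have hlift := primrec_label_comp_unlabel hκ hu huκ
  have hself := hlift id Primrec.id id Primrec.id fun _ _ _ => rfl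
  obtain ⟨c, hc, hc'⟩ := exists_equiv_of_primrec_retract (label κ u) (unlabel κ)
    (primrec_label hκ hu) unlabel_label hself
  have hsucc : Primrec fun x => c (c.symm x + 1) :=
    hc _ <| hlift _ Primrec.succ (fun p => (p.1, p.2 + 1))
      (Primrec.fst.pair (Primrec.succ.comp Primrec.snd)) fun _ _ _ => rfl
  have hdouble : Primrec fun x => c (2 * c.symm x) :=
    hc (fun n => 2 * n) <| hlift _ (Primrec.nat_mul.comp (Primrec.const 2) Primrec.id)
      (fun p => (p.1 + 1, 2 * p.2))
      ((Primrec.succ.comp Primrec.fst).pair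
        (Primrec.nat_mul.comp (Primrec.const 2) Primrec.snd))
      fun _ _ _ => by ring
  refine ⟨c, hsucc, hdouble, fun m b hm => ⟨fun h => ?_, ?_⟩⟩
  · obtain ⟨g, hg, hgl⟩ := hc' (fun n => m * n + b) h
    have hf : Primrec fun s : ℕ => (g (s + 1, 0, 0)).2.1 + m + b :=
      Primrec.nat_add.comp (Primrec.nat_add.comp (Primrec.fst.comp (Primrec.snd.comp
        (hg.comp (Primrec.succ.pair (Primrec.const (0, 0)))))) (Primrec.const m))
        (Primrec.const b)
    obtain ⟨s, hs⟩ := hdom _ hf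
    have hlt := hs s le_rfl
    have hlabel : label κ u (2 ^ (κ s * κ s)) = (s + 1, 0, 0) :=
      label_two_pow_add huκ (a := 0) (b := 0) (by omega) (by omega)
    rw [← hlabel, hgl] at hlt
    exact eq_two_pow_of_label (κ := κ) (u := u) (s := s) (b := b) hm (by omega) (by omega) (by omega)
  · rintro ⟨a, rfl⟩
    have hpow : Primrec fun x => c (2 ^ a * c.symm x) := by
      clear hm
      induction a with
      | zero => simpa using! Primrec.id
      | succ a ih =>
        refine (hdouble.comp ih).of_eq fun x => ?_
        rw [c.symm_apply_apply, pow_succ']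
        ring_nf
    induction b with
    | zero => exact hpow
    | succ b ih =>
      refine (hsucc.comp ih).of_eq fun x => ?_
      rw [c.symm_apply_apply, add_assoc]
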